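/- arXiv:2409.19150 — 2 statements merged into one kernel-verified Lean document; each statement's English description precedes it below -/
import Mathlib

section
/- Let Σ be a finite alphabet and Q a finite state set with |Σ| ≥ 2 and |Q| ≥ 2, and let 𝔻 = Σ ∪ Q ∪ {⟨PAD⟩} with d = ⌈log₂|𝔻|⌉ + 1. For every function f : Σ^n → Q computed by a deterministic finite automaton, and every context length L ≥ n, there exists a decision tree 𝒯 over {0,1}^{L·d} of size at most 2^{2d} (hence O(|𝔻|²)) and depth at most 2d (hence O(log|𝔻|)) such that for every input x ∈ Σ^n, the induced auto-regressive decision tree 𝒯^AR satisfies 𝒯^AR_i(x) = q_i for every i ∈ {1,…,n}, where q_i is the state of the automaton after reading x_1,…,x_i; in particular 𝒯^AR_n(x) = f(x), so the class ℱ^Aut_n is simulated by ARDTs of size O(|𝔻|²), depth O(log|𝔻|) and context length L ≥ n in length complexity O(n). -/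
/-- A decision tree over boolean inputs indexed by `ι`, with outputs in `β`.
Internal nodes are labeled by a coordinate; leaves are labeled by output values. -/
inductive DTree (ι : Type*) (β : Type*) where
  | leaf : β → DTree ι β
  | node : ι → DTree ι β → DTree ι β → DTree ι β

namespace DTree

variable {ι β : Type*}

/-- Evaluate a decision tree on an input: at a node labeled `i`, go right if
the `i`-th coordinate is `1` (true), left otherwise; output the leaf label. -/
def eval : DTree ι β → (ι → Bool) → β
  | leaf b, _ => b
  | node i l r, x => if x i then r.eval x else l.eval x

/-- The size of a decision tree is its number of leaves. -/
def size : DTree ι β → ℕ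
  | leaf _ => 1
  | node _ l r => l.size + r.size

/-- The depth of a decision tree is the maximum length of a root-to-leaf path. -/
def depth : DTree ι β → ℕ
  | leaf _ => 0
  | node _ l r => max l.depth r.depth + 1

end DTree

section ARDT

variable {D : Type*} {d : ℕ}

/-- The length-`L` context window of a token sequence `s`: keep only the last `L`
tokens of `s`, prepending `⟨PAD⟩` tokens if `s` is shorter than `L`. -/
def window (pad : D) (L : ℕ) (s : List D) : Fin L → D := fun i =>
  (List.replicate (L - s.length) pad ++ List.drop (s.length - L) s).getD i pad

/-- The boolean input fed to a context-length-`L` decision tree on token sequence `s`: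
the concatenation of the embeddings (under `Ψ`) of the `L` tokens in the window. -/
def encodeWindow (Ψ : D → Fin d → Bool) (pad : D) (L : ℕ) (s : List D) :
    Fin (L * d) → Bool := fun p =>
  Ψ (window pad L s (finProdFinEquiv.symm p).1) (finProdFinEquiv.symm p).2

/-- The token sequence obtained from `s` after `k` steps of auto-regressive generation
with the decision tree `T` as next-token predictor. -/
def ardtSeq (Ψ : D → Fin d → Bool) (pad : D) (L : ℕ) (T : DTree (Fin (L * d)) D)
    (s : List D) : ℕ → List D
  | 0 => s
  | k + 1 =>
      ardtSeq Ψ pad L T s k ++ [T.eval (encodeWindow Ψ pad L (ardtSeq Ψ pad L T s k))]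

/-- `𝒯^AR_i(s)`: the `i`-th token (for `i ≥ 1`) generated by the auto-regressive
decision tree induced by `T` on input sequence `s`. -/
def ardtOut (Ψ : D → Fin d → Bool) (pad : D) (L : ℕ) (T : DTree (Fin (L * d)) D)
    (s : List D) (i : ℕ) : D :=
  T.eval (encodeWindow Ψ pad L (ardtSeq Ψ pad L T s (i - 1)))

end ARDT

/-- The token dictionary for automaton simulation: `𝔻 = Σ ∪ Q ∪ {⟨PAD⟩}`,
with `none` playing the role of the padding token `⟨PAD⟩`. -/
abbrev AutTok (A Q : Type*) : Type _ := Option (A ⊕ Q)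

/-- The embedding dimension `d = ⌈log₂ |𝔻|⌉ + 1` for `𝔻 = Σ ∪ Q ∪ {⟨PAD⟩}`. -/
abbrev autDim (A Q : Type*) [Fintype A] [Fintype Q] : ℕ :=
  Nat.clog 2 (Fintype.card (AutTok A Q)) + 1

namespace DTree

variable {ι β : Type*}

/-- A function depending only on the coordinates in `c` is computed by a complete decision tree
that queries those coordinates. -/
theorem exists_eval_eq [DecidableEq ι] (c : List ι) (F : (ι → Bool) → β)
    (hF : ∀ x y : ι → Bool, (∀ i ∈ c, x i = y i) → F x = F y) :
    ∃ T : DTree ι β, T.size ≤ 2 ^ c.length ∧ T.depth ≤ c.length ∧ ∀ x, T.eval x = F x := by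
  induction c generalizing F with
  | nil => exact ⟨leaf (F fun _ => false), by simp [size], by simp [depth],
      fun x => hF _ _ (by simp)⟩
  | cons i c ih =>
    have h (b : Bool) : ∀ x y : ι → Bool, (∀ j ∈ c, x j = y j) →
        F (Function.update x i b) = F (Function.update y i b) := by
      intro x y hxy
      refine hF _ _ fun j hj => ?_
      by_cases hji : j = i
      · simp [hji]
      · simpa [hji] using hxy j ((List.mem_cons.1 hj).resolve_left hji)
    obtain ⟨l, hls, hld, hl⟩ := ih _ (h false)
    obtain ⟨r, hrs, hrd, hr⟩ := ih _ (h true)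
    refine ⟨node i l r, ?_, ?_, fun x => ?_⟩
    · simp only [size, List.length_cons, pow_succ]
      omega
    · simp only [depth, List.length_cons]
      omega
    · cases hx : x i
      · rw [eval, hx, if_neg Bool.false_ne_true, hl, ← hx, Function.update_eq_self]
      · rw [eval, hx, if_pos rfl, hr, ← hx, Function.update_eq_self]

end DTree

section ARDT

variable {D : Type*} {d : ℕ}

theorem window_eq_getD (pad : D) {L m : ℕ} (s : List D) (hm : 0 < m) (hmL : m ≤ L)
    (hms : m ≤ s.length) :
    window pad L s ⟨L - m, by omega⟩ = s.getD (s.length - m) pad := by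
  unfold window
  rw [List.getD_append_right _ _ _ _ (by simp; omega)]
  simp only [List.length_replicate, List.getD_eq_getElem?_getD, List.getElem?_drop]
  congr 2
  omega

/-- Any function of two window tokens is computed by a decision tree of depth at most `2 * d`. -/
theorem exists_dtree_window_pair [Nonempty D] {Ψ : D → Fin d → Bool}
    (hΨ : Function.Injective Ψ) (pad : D) {L : ℕ} (i j : Fin L) (h : D → D → D) :
    ∃ T : DTree (Fin (L * d)) D, T.size ≤ 2 ^ (2 * d) ∧ T.depth ≤ 2 * d ∧
      ∀ s, T.eval (encodeWindow Ψ pad L s) = h (window pad L s i) (window pad L s j) := by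
  let token (k : Fin L) (e : Fin (L * d) → Bool) : D :=
    Function.invFun Ψ fun b => e (finProdFinEquiv (k, b))
  obtain ⟨T, hs, hd, hT⟩ := DTree.exists_eval_eq
    ((List.ofFn fun b : Fin d => finProdFinEquiv (i, b)) ++
      List.ofFn fun b : Fin d => finProdFinEquiv (j, b))
    (fun e => h (token i e) (token j e)) (by
      intro x y hxy
      have hi : token i x = token i y := by
        refine congrArg (Function.invFun Ψ) (funext fun b => hxy _ ?_)
        simp [List.mem_ofFn]
      have hj : token j x = token j y := by
        refine congrArg (Function.invFun Ψ) (funext fun b => hxy _ ?_)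
        simp [List.mem_ofFn]
      simp only [hi, hj])
  have token_encodeWindow (k : Fin L) (s : List D) :
      token k (encodeWindow Ψ pad L s) = window pad L s k := by
    simp only [token, encodeWindow, Equiv.symm_apply_apply]
    exact Function.leftInverse_invFun hΨ _
  simp only [List.length_append, List.length_ofFn, ← two_mul] at hs hd
  exact ⟨T, hs, hd, fun s => by rw [hT, token_encodeWindow, token_encodeWindow]⟩

end ARDT

/-- The next-token rule simulating an automaton: the first argument is the latest token, the
second the input letter to be read. A latest token that is not a state stands for `q0`. -/
def autStep {A Q : Type*} (q0 : Q) (δ : Q → A → Q) : AutTok A Q → AutTok A Q → AutTok A Q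
  | some (Sum.inr q), some (Sum.inl a) => some (Sum.inr (δ q a))
  | _, some (Sum.inl a) => some (Sum.inr (δ q0 a))
  | _, _ => none

/-- The sequence consisting of an input word followed by the first `k` automaton states. -/
def autTrace {A Q : Type*} (q0 : Q) (δ : Q → A → Q) (xs : List A) (k : ℕ) : List (AutTok A Q) :=
  xs.map (fun a => some (Sum.inl a)) ++
    (List.range k).map fun j => some (Sum.inr (List.foldl δ q0 (xs.take (j + 1))))

theorem length_autTrace {A Q : Type*} (q0 : Q) (δ : Q → A → Q) (xs : List A) (k : ℕ) :
    (autTrace q0 δ xs k).length = xs.length + k := by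
  simp [autTrace]

theorem autStep_autTrace {A Q : Type*} (q0 : Q) (δ : Q → A → Q) (xs : List A) {k : ℕ}
    (hk : k < xs.length) :
    autStep q0 δ ((autTrace q0 δ xs k).getD (xs.length + k - 1) none)
        ((autTrace q0 δ xs k).getD k none) =
      some (Sum.inr (List.foldl δ q0 (xs.take (k + 1)))) := by
  have hletter : (autTrace q0 δ xs k).getD k none = some (Sum.inl xs[k]) := by
    unfold autTrace
    rw [List.getD_append _ _ _ _ (by simpa using hk)]
    simp [List.getD_eq_getElem?_getD, hk]
  rw [hletter, List.take_succ_eq_append_getElem hk, List.foldl_concat]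
  cases k with
  | zero =>
    have hlast : (autTrace q0 δ xs 0).getD (xs.length + 0 - 1) none =
        some (Sum.inl xs[xs.length - 1]) := by
      simp [autTrace, List.getD_eq_getElem?_getD,
        List.getElem?_eq_getElem (Nat.sub_lt hk one_pos)]
    rw [hlast]
    simp [autStep]
  | succ k =>
    have hlast : (autTrace q0 δ xs (k + 1)).getD (xs.length + (k + 1) - 1) none =
        some (Sum.inr (List.foldl δ q0 (xs.take (k + 1)))) := by
      unfold autTrace
      rw [List.getD_append_right _ _ _ _ (by simp)]
      simp [List.getD_eq_getElem?_getD]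
    rw [hlast]
    simp [autStep]

theorem autTrace_succ {A Q : Type*} (q0 : Q) (δ : Q → A → Q) (xs : List A) (k : ℕ) :
    autTrace q0 δ xs (k + 1) =
      autTrace q0 δ xs k ++ [some (Sum.inr (List.foldl δ q0 (xs.take (k + 1))))] := by
  simp [autTrace, List.range_succ]

/-- ARDTs simulate deterministic finite automata: for every
`f : Σ^n → Q` computed by a DFA `(q₀, δ)` and every context length `L ≥ n`, there is
a decision tree over `{0,1}^{L·d}` of size `≤ 2^{2d}` and depth `≤ 2d` whose induced
auto-regressive decision tree outputs, on input `x ∈ Σ^n`, the automaton state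
`qᵢ = δ(q_{i-1}, xᵢ)` as its `i`-th generated token for each `1 ≤ i ≤ n`;
in particular its `n`-th generated token is `f(x)`. -/
theorem ardt_simulates_automata {A Q : Type*} [Fintype A] [Fintype Q]
    (hA : 2 ≤ Fintype.card A) (hQ : 2 ≤ Fintype.card Q)
    {n : ℕ} (f : (Fin n → A) → Q) (q0 : Q) (δ : Q → A → Q)
    (hf : ∀ x : Fin n → A, f x = List.foldl δ q0 (List.ofFn x))
    (L : ℕ) (hL : n ≤ L)
    (Ψ : AutTok A Q → Fin (autDim A Q) → Bool)
    (hΨ : Function.Injective Ψ) (hΨ1 : ∀ s : AutTok A Q, Ψ s 0 = true) :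
    ∃ T : DTree (Fin (L * autDim A Q)) (AutTok A Q),
      T.size ≤ 2 ^ (2 * autDim A Q) ∧
      T.depth ≤ 2 * autDim A Q ∧
      (∀ x : Fin n → A, ∀ i : ℕ, 1 ≤ i → i ≤ n →
        ardtOut Ψ none L T (List.ofFn fun j => (some (Sum.inl (x j)) : AutTok A Q)) i
          = some (Sum.inr (List.foldl δ q0 ((List.ofFn x).take i)))) ∧
      ∀ x : Fin n → A,
        ardtOut Ψ none L T (List.ofFn fun j => (some (Sum.inl (x j)) : AutTok A Q)) n
          = some (Sum.inr (f x)) := by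
  rcases Nat.eq_zero_or_pos n with rfl | hn
  · refine ⟨DTree.leaf (some (Sum.inr q0)), Nat.one_le_two_pow, Nat.zero_le _, ?_, ?_⟩
    · intro x i h1 h2
      omega
    · intro x
      simp [ardtOut, DTree.eval, hf]
  obtain ⟨T, hs, hd, hT⟩ := exists_dtree_window_pair hΨ none
    (⟨L - 1, by omega⟩ : Fin L) ⟨L - n, by omega⟩ (autStep q0 δ)
  have heval (x : Fin n → A) {k : ℕ} (hk : k < n) :
      T.eval (encodeWindow Ψ none L (autTrace q0 δ (List.ofFn x) k)) =
        some (Sum.inr (List.foldl δ q0 ((List.ofFn x).take (k + 1)))) := by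
    have hlen : (autTrace q0 δ (List.ofFn x) k).length = n + k := by
      simp [length_autTrace]
    rw [hT, window_eq_getD none _ one_pos (by omega) (by omega),
      window_eq_getD none _ hn hL (by omega), hlen, Nat.add_sub_cancel_left]
    simpa using autStep_autTrace q0 δ (List.ofFn x) (k := k) (by simpa using hk)
  have hseq (x : Fin n → A) : ∀ k < n,
      ardtSeq Ψ none L T (List.ofFn fun j => (some (Sum.inl (x j)) : AutTok A Q)) k =
        autTrace q0 δ (List.ofFn x) k := by
    intro k
    induction k with
    | zero => simp [ardtSeq, autTrace, List.map_ofFn, Function.comp_def]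
    | succ k ih =>
      intro hk
      rw [ardtSeq, ih (by omega), heval x (by omega), autTrace_succ]
  have hout (x : Fin n → A) (i : ℕ) (h1 : 1 ≤ i) (hi : i ≤ n) :
      ardtOut Ψ none L T (List.ofFn fun j => (some (Sum.inl (x j)) : AutTok A Q)) i
        = some (Sum.inr (List.foldl δ q0 ((List.ofFn x).take i))) := by
    rw [ardtOut, hseq x (i - 1) (by omega), heval x (by omega), Nat.sub_add_cancel h1]
  refine ⟨T, hs, hd, hout, fun x => ?_⟩
  rw [hout x n hn le_rfl, hf, List.take_of_length_le (by simp)]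
end

section
/- Let Σ be a finite alphabet, Q a finite state set, and 𝔻 = Σ ∪ Q ∪ {⟨PAD⟩, ⟨SEP⟩} with d = ⌈log₂|𝔻|⌉ + 1. For every Turing machine ℳ with state set Q, alphabet Σ, tape of M cells and runtime T, there exists a decision tree 𝒯 over {0,1}^{(M+3)·d} of size at most 2^{4d} (hence O(|𝔻|⁴)) and depth at most 4d (hence O(log|𝔻|)), with context length L = M + 3, such that for every input written on the tape, the induced ARDT applied to the input (prepended with ⟨PAD⟩ tokens) generates, for each i ∈ {1,…,T}, the block of M+2 tokens (⟨SEP⟩, s_i), where s_i ∈ 𝔻^{M+1} is the encoding of the configuration of ℳ at step i; in particular, the class ℱ^Turing_{M,T} is simulated by ARDTs of size O(|𝔻|⁴), depth O(log|𝔻|) and context length M + 3 in length complexity O(MT) (precisely T(M+2) generated tokens). -/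
/-- The token dictionary for Turing machine simulation:
`𝔻 = Σ ∪ Q ∪ {⟨PAD⟩, ⟨SEP⟩}`. -/
inductive TMTok (A Q : Type*) where
  | sym : A → TMTok A Q
  | st : Q → TMTok A Q
  | pad : TMTok A Q
  | sep : TMTok A Q
  deriving DecidableEq

/-- A head movement of a Turing machine. -/
inductive TMMove where
  | left : TMMove
  | right : TMMove

/-- A configuration of a Turing machine with a tape of `M` cells: the tape contents,
the head position, and the current state. -/
structure TMConfig (A Q : Type*) (M : ℕ) where
  tape : Fin M → A
  pos : Fin M
  state : Q

/-- One step of the Turing machine with transition function `δ`: read the symbol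
under the head, and according to `δ` write a symbol, change state, and move the head
one cell left or right (staying in place at the ends of the tape). -/
def TMstep {A Q : Type*} {M : ℕ} (δ : Q → A → Q × A × TMMove)
    (c : TMConfig A Q M) : TMConfig A Q M :=
  { tape := Function.update c.tape c.pos (δ c.state (c.tape c.pos)).2.1
    pos := match (δ c.state (c.tape c.pos)).2.2 with
      | .left => ⟨(c.pos : ℕ) - 1, by have := c.pos.isLt; omega⟩
      | .right => ⟨min ((c.pos : ℕ) + 1) (M - 1), by have := c.pos.isLt; omega⟩
    state := (δ c.state (c.tape c.pos)).1 }

/-- The encoding of a configuration with tape `m₁,…,m_M`, head at (1-indexed)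
position `i` in state `q` as the string `(m₁,…,m_{i−1}, q, m_i,…,m_M) ∈ 𝔻^{M+1}`
(the state token is inserted immediately before the cell under the head), indexed by
1-indexed positions `j ∈ {1,…,M+1}`; positions outside this range read as the
padding token. -/
def encodeConfig {A Q : Type*} {M : ℕ} (c : TMConfig A Q M) (j : ℕ) : TMTok A Q :=
  if h : 1 ≤ j ∧ j ≤ M + 1 then
    if h1 : j - 1 < (c.pos : ℕ) then
      TMTok.sym (c.tape ⟨j - 1, by have := c.pos.isLt; omega⟩)
    else if h2 : j - 1 = (c.pos : ℕ) then TMTok.st c.state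
    else TMTok.sym (c.tape ⟨j - 2, by have := c.pos.isLt; omega⟩)
  else TMTok.pad

instance {A Q : Type*} [Fintype A] [Fintype Q] : Fintype (TMTok A Q) :=
  Fintype.ofEquiv (A ⊕ Q ⊕ Bool)
    { toFun := fun t => match t with
        | .inl a => TMTok.sym a
        | .inr (.inl q) => TMTok.st q
        | .inr (.inr false) => TMTok.pad
        | .inr (.inr true) => TMTok.sep
      invFun := fun t => match t with
        | .sym a => .inl a
        | .st q => .inr (.inl q)
        | .pad => .inr (.inr false)
        | .sep => .inr (.inr true)
      left_inv := fun t => by rcases t with a | q | b <;> first | rfl | (cases b <;> rfl)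
      right_inv := fun t => by cases t <;> rfl }

/-- The embedding dimension `d = ⌈log₂ |𝔻|⌉ + 1` for `𝔻 = Σ ∪ Q ∪ {⟨PAD⟩, ⟨SEP⟩}`. -/
abbrev tmDim (A Q : Type*) [Fintype A] [Fintype Q] : ℕ :=
  Nat.clog 2 (Fintype.card (TMTok A Q)) + 1

namespace DTree

variable {ι β : Type*}

/-- Every function of the bits read along a list of coordinates is computed by the complete
decision tree which queries these coordinates in order. -/
theorem exists_eval_eq_map (l : List ι) (g : List Bool → β) :
    ∃ T : DTree ι β, T.size = 2 ^ l.length ∧ T.depth = l.length ∧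
      ∀ x, T.eval x = g (l.map x) := by
  induction l generalizing g with
  | nil => exact ⟨leaf (g []), by simp [size], by simp [depth], fun x => by simp [eval]⟩
  | cons i l ih =>
    obtain ⟨T₀, hs₀, hd₀, he₀⟩ := ih fun bs => g (false :: bs)
    obtain ⟨T₁, hs₁, hd₁, he₁⟩ := ih fun bs => g (true :: bs)
    refine ⟨node i T₀ T₁, ?_, ?_, fun x => ?_⟩
    · simp [size, hs₀, hs₁, pow_succ, mul_two]
    · simp [depth, hd₀, hd₁]
    · cases h : x i <;> simp [eval, h, he₀, he₁]

end DTree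

/-- A next-token rule depending only on the first `n` tokens of the context window is computed by
a decision tree of depth `n * d`. -/
theorem exists_dtree_eval_encodeWindow {D : Type*} {d : ℕ} {Ψ : D → Fin d → Bool}
    (hΨ : Function.Injective Ψ) (pad : D) {n L : ℕ} (hn : n ≤ L) (f : (Fin n → D) → D) :
    ∃ T : DTree (Fin (L * d)) D, T.size = 2 ^ (n * d) ∧ T.depth = n * d ∧
      ∀ s, T.eval (encodeWindow Ψ pad L s) =
        f fun i => window pad L s (Fin.castLE hn i) := by
  have : Nonempty D := ⟨pad⟩
  set E : (Fin n → D) → List Bool := fun w =>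
    List.ofFn fun p : Fin (n * d) => Ψ (w (finProdFinEquiv.symm p).1) (finProdFinEquiv.symm p).2
    with hE
  have hEinj : Function.Injective E := by
    intro w w' h
    have h' := List.ofFn_injective h
    funext i
    refine hΨ (funext fun k => ?_)
    simpa using congrFun h' (finProdFinEquiv (i, k))
  obtain ⟨g, hg⟩ := hEinj.hasLeftInverse
  obtain ⟨T, hs, hd, he⟩ := DTree.exists_eval_eq_map
    (List.ofFn fun p : Fin (n * d) =>
      (finProdFinEquiv (Fin.castLE hn (finProdFinEquiv.symm p).1, (finProdFinEquiv.symm p).2) :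
        Fin (L * d)))
    (f ∘ g)
  refine ⟨T, by simpa using hs, by simpa using hd, fun s => ?_⟩
  have key : (List.ofFn fun p : Fin (n * d) =>
      (finProdFinEquiv (Fin.castLE hn (finProdFinEquiv.symm p).1, (finProdFinEquiv.symm p).2) :
        Fin (L * d))).map (encodeWindow Ψ pad L s) =
      E fun i => window pad L s (Fin.castLE hn i) := by
    rw [List.map_ofFn, hE]
    congr 1
    funext p
    simp only [Function.comp, encodeWindow, Equiv.symm_apply_apply]
  rw [he, key]
  exact congrArg f (hg fun i => window pad L s (Fin.castLE hn i))

/-- Auto-regressive generation follows a target sequence `t` as soon as the tree predicts the next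
token of `t` from each prefix. -/
theorem ardtSeq_eq_append_map {D : Type*} {d L : ℕ} {Ψ : D → Fin d → Bool} {pad : D}
    {T : DTree (Fin (L * d)) D} {s : List D} {t : ℕ → D}
    (h : ∀ k, T.eval (encodeWindow Ψ pad L (s ++ (List.range k).map t)) = t k) (k : ℕ) :
    ardtSeq Ψ pad L T s k = s ++ (List.range k).map t := by
  induction k with
  | zero => simp [ardtSeq]
  | succ k ih => rw [ardtSeq, ih, h]; simp [List.range_succ]

section EncodeConfig

variable {A Q : Type*} {M : ℕ} (c : TMConfig A Q M)

theorem encodeConfig_of_lt {k : ℕ} (h : k < c.pos) :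
    encodeConfig c (k + 1) = TMTok.sym (c.tape ⟨k, h.trans c.pos.isLt⟩) := by
  have := c.pos.isLt
  simp [encodeConfig, h, show k ≤ M by omega]

theorem encodeConfig_pos {k : ℕ} (h : k = c.pos) :
    encodeConfig c (k + 1) = TMTok.st c.state := by
  have := c.pos.isLt
  simp [encodeConfig, h]

theorem encodeConfig_of_le {k : ℕ} (h : (c.pos : ℕ) ≤ k) (hk : k < M) :
    encodeConfig c (k + 2) = TMTok.sym (c.tape ⟨k, hk⟩) := by
  simp [encodeConfig, show k + 1 ≤ M by omega, show ¬ k + 1 < c.pos by omega,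
    show k + 1 ≠ c.pos by omega]

end EncodeConfig

/-- The local rule for generating encoded configurations: from the three tokens of the previous
configuration around the current position and the one after them, compute the current token of the
next configuration. The tokens `⟨PAD⟩` mark the start of the generation. -/
def tmRule {A Q : Type*} (δ : Q → A → Q × A × TMMove) (q0 : Q) (w0 w1 w2 w3 : TMTok A Q) :
    TMTok A Q :=
  match w1 with
  | .sep => .sep
  | .pad => match w2 with
    | .pad => .sep
    | _ => .st q0
  | .st q => match w2 with
    | .sym b => match (δ q b).2.2 with
      | .left => match w0 with
        | .sym a => .sym a
        | _ => .st (δ q b).1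
      | .right => match w3 with
        | .sep => .st (δ q b).1
        | _ => .sym (δ q b).2.1
    | _ => .pad
  | .sym a => match w0 with
    | .st q => match (δ q a).2.2 with
      | .left => .sym (δ q a).2.1
      | .right => match w2 with
        | .sep => .sym (δ q a).2.1
        | _ => .st (δ q a).1
    | _ => match w2 with
      | .st q => match w3 with
        | .sym b => match (δ q b).2.2 with
          | .left => .st (δ q b).1
          | .right => .sym a
        | _ => .sym a
      | _ => .sym a

/-- The tokens of the encoding of `c`, enclosed between two separators. -/
def sepEncode {A Q : Type*} {M : ℕ} (c : TMConfig A Q M) (r : ℕ) : TMTok A Q :=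
  if r = 0 ∨ r = M + 2 then .sep else encodeConfig c r

theorem tmRule_sepEncode {A Q : Type*} {M : ℕ} (δ : Q → A → Q × A × TMMove) (q0 : Q)
    (c : TMConfig A Q M) {k : ℕ} (hk : k ≤ M) (w : TMTok A Q)
    (hw : k + 3 ≤ M + 2 → w = sepEncode c (k + 3)) :
    tmRule δ q0 (sepEncode c k) (sepEncode c (k + 1)) (sepEncode c (k + 2)) w =
      encodeConfig (TMstep δ c) (k + 1) := by
  have hp := c.pos.isLt
  have hL : (δ c.state (c.tape c.pos)).2.2 = .left →
      ((TMstep δ c).pos : ℕ) = c.pos - 1 := fun h => by simp [TMstep, h]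
  have hR : (δ c.state (c.tape c.pos)).2.2 = .right →
      ((TMstep δ c).pos : ℕ) = min ((c.pos : ℕ) + 1) (M - 1) := fun h => by simp [TMstep, h]
  have hst : (TMstep δ c).state = (δ c.state (c.tape c.pos)).1 := rfl
  have htape : ∀ (n : ℕ) (hn : n < M), n ≠ c.pos → (TMstep δ c).tape ⟨n, hn⟩ = c.tape ⟨n, hn⟩ :=
    fun n hn hne => Function.update_of_ne (by simpa [Fin.ext_iff] using hne) _ _
  have hhead : ∀ (n : ℕ) (hn : n < M), n = c.pos →
      (TMstep δ c).tape ⟨n, hn⟩ = (δ c.state (c.tape c.pos)).2.1 := by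
    rintro n hn rfl
    exact Function.update_self _ _ _
  have sep_last : ∀ n, n = M + 2 → sepEncode c n = .sep := fun n h => by simp [sepEncode, h]
  have enc_lt : ∀ (n : ℕ) (h : n < c.pos),
      sepEncode c (n + 1) = .sym (c.tape ⟨n, h.trans hp⟩) := fun n h => by
    rw [sepEncode, if_neg (by omega), encodeConfig_of_lt c h]
  have enc_pos : ∀ n : ℕ, n = c.pos → sepEncode c (n + 1) = .st c.state := fun n h => by
    rw [sepEncode, if_neg (by omega), encodeConfig_pos c h]
  have enc_le : ∀ (n : ℕ) (_ : (c.pos : ℕ) ≤ n) (hn : n < M),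
      sepEncode c (n + 2) = .sym (c.tape ⟨n, hn⟩) := fun n h hn => by
    rw [sepEncode, if_neg (by omega), encodeConfig_of_le c h hn]
  have enc_zero : sepEncode c 0 = .sep := by simp [sepEncode]
  have mv : (δ c.state (c.tape c.pos)).2.2 = .left ∨ (δ c.state (c.tape c.pos)).2.2 = .right := by
    cases (δ c.state (c.tape c.pos)).2.2 <;> simp
  have hge : (c.pos : ℕ) - 1 ≤ (TMstep δ c).pos := by
    rcases mv with h | h
    · rw [hL h]
    · rw [hR h]; omega
  have hle : ((TMstep δ c).pos : ℕ) ≤ c.pos + 1 := by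
    rcases mv with h | h
    · rw [hL h]; omega
    · rw [hR h]; omega
  rcases lt_trichotomy k (c.pos : ℕ) with hlt | heq | hgt
  · have h0 : sepEncode c k = .sep ∨ ∃ a, sepEncode c k = .sym a := by
      rcases k with _ | k
      · exact .inl enc_zero
      · exact .inr ⟨_, enc_lt k (by omega)⟩
    rw [enc_lt k hlt]
    rcases (show k + 1 ≤ c.pos from hlt).lt_or_eq with hlt' | heq'
    · rw [enc_lt (k + 1) hlt', encodeConfig_of_lt _ (by omega), htape _ _ hlt.ne]
      rcases h0 with h0 | ⟨a, h0⟩ <;> simp [tmRule, h0]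
    · rw [enc_pos (k + 1) heq', hw (by omega), enc_le (k + 1) (by omega) (by omega)]
      have hcell : c.tape ⟨k + 1, by omega⟩ = c.tape c.pos := congrArg _ (Fin.ext heq')
      rcases mv with h | h
      · rw [encodeConfig_pos _ (by rw [hL h]; omega), hst]
        rcases h0 with h0 | ⟨a, h0⟩ <;> simp [tmRule, h0, hcell, h]
      · rw [encodeConfig_of_lt _ (by rw [hR h]; omega), htape _ _ hlt.ne]
        rcases h0 with h0 | ⟨a, h0⟩ <;> simp [tmRule, h0, hcell, h]
  · rw [enc_pos k heq, enc_le k heq.ge (by omega)]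
    have hcell : c.tape ⟨k, by omega⟩ = c.tape c.pos := congrArg _ (Fin.ext heq)
    rcases mv with h | h
    · rcases k with _ | k
      · rw [encodeConfig_pos _ (by rw [hL h]; omega), hst, enc_zero]
        simp [tmRule, hcell, h]
      · rw [encodeConfig_of_le _ (by rw [hL h]; omega) (by omega), htape _ _ (by omega),
          enc_lt k (by omega)]
        simp [tmRule, hcell, h]
    · rw [hw (by omega)]
      by_cases hlast : k + 1 = M
      · rw [encodeConfig_pos _ (by rw [hR h]; omega), hst, sep_last (k + 3) (by omega)]
        simp [tmRule, hcell, h]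
      · rw [encodeConfig_of_lt _ (by rw [hR h]; omega), hhead _ _ heq,
          enc_le (k + 1) (by omega) (by omega)]
        simp [tmRule, hcell, h]
  · obtain ⟨k, rfl⟩ : ∃ n, k = n + 1 := ⟨k - 1, by omega⟩
    have h2 : k + 1 = M ∧ sepEncode c (k + 1 + 2) = .sep ∨
        k + 1 < M ∧ ∃ a, sepEncode c (k + 1 + 2) = .sym a := by
      rcases hk.eq_or_lt with h | h
      · exact .inl ⟨h, sep_last _ (by omega)⟩
      · exact .inr ⟨h, _, enc_le (k + 1) (by omega) h⟩
    rw [enc_le k (by omega) hk]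
    rcases (show (c.pos : ℕ) ≤ k by omega).eq_or_lt with heq' | hlt'
    · have hcell : c.tape ⟨k, hk⟩ = c.tape c.pos := congrArg _ (Fin.ext heq'.symm)
      rw [enc_pos k heq'.symm]
      rcases mv with h | h
      · rw [encodeConfig_of_le _ (by rw [hL h]; omega) hk, hhead _ _ heq'.symm]
        simp [tmRule, hcell, h]
      · rcases h2 with ⟨hM, h2⟩ | ⟨hM, a, h2⟩
        · rw [encodeConfig_of_le _ (by rw [hR h]; omega) hk, hhead _ _ heq'.symm]
          simp [tmRule, hcell, h, h2]
        · rw [encodeConfig_pos _ (by rw [hR h]; omega), hst]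
          simp [tmRule, hcell, h, h2]
    · obtain ⟨k, rfl⟩ : ∃ n, k = n + 1 := ⟨k - 1, by omega⟩
      rw [encodeConfig_of_le _ (by omega) hk, htape _ _ hlt'.ne', enc_le k (by omega) (by omega)]
      rcases h2 with ⟨-, h2⟩ | ⟨-, a, h2⟩ <;> simp [tmRule, h2]

/-- The sequence generated by the simulation: the encoded configurations, each one preceded by a
separator. -/
def tmTarget {A Q : Type*} {M : ℕ} (δ : Q → A → Q × A × TMMove) (c : TMConfig A Q M) (k : ℕ) :
    TMTok A Q :=
  sepEncode ((TMstep δ)^[k / (M + 2)] c) (k % (M + 2))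

theorem tmTarget_mul_add {A Q : Type*} {M : ℕ} (δ : Q → A → Q × A × TMMove)
    (c : TMConfig A Q M) (b : ℕ) {r : ℕ} (hr : r ≤ M + 2) :
    tmTarget δ c ((M + 2) * b + r) = sepEncode ((TMstep δ)^[b] c) r := by
  rcases hr.lt_or_eq with hr | rfl
  · rw [tmTarget, Nat.mul_add_div (by omega), Nat.mul_add_mod, Nat.div_eq_of_lt hr,
      Nat.mod_eq_of_lt hr, add_zero]
  · rw [← Nat.mul_succ, tmTarget, Nat.mul_mod_right]
    simp [sepEncode]

/-- The input on the tape preceded by three `⟨PAD⟩` tokens and followed by the generated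
sequence. -/
def tmHistory {A Q : Type*} {M : ℕ} (δ : Q → A → Q × A × TMMove) (c : TMConfig A Q M) (n : ℕ) :
    TMTok A Q :=
  if n < 3 then .pad
  else if h : n - 3 < M then .sym (c.tape ⟨n - 3, h⟩)
  else tmTarget δ c (n - 3 - M)

theorem window_append_map_tmTarget {A Q : Type*} {M : ℕ} (δ : Q → A → Q × A × TMMove)
    (c : TMConfig A Q M) (k : ℕ) (i : Fin (M + 3)) :
    window .pad (M + 3)
      ((List.ofFn fun j => TMTok.sym (c.tape j)) ++ (List.range k).map (tmTarget δ c)) i =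
      tmHistory δ c (k + i) := by
  have hi := i.isLt
  simp only [window, tmHistory, List.length_append, List.length_ofFn, List.length_map,
    List.length_range]
  rcases lt_or_ge (i : ℕ) (M + 3 - (M + k)) with h | h
  · rw [List.getD_append _ _ _ _ (by simpa using h), List.getD_replicate _ h, if_pos (by omega)]
  · rw [List.getD_append_right _ _ _ _ (by simpa using h), if_neg (by omega),
      List.getD_eq_getElem?_getD, List.getElem?_drop, List.length_replicate,
      show M + k - (M + 3) + (i - (M + 3 - (M + k))) = k + i - 3 by omega]
    split_ifs with hlt
    · rw [List.getElem?_append_left (by simpa using hlt)]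
      simp [hlt]
    · rw [List.getElem?_append_right (by simpa using hlt), List.length_ofFn,
        List.getElem?_map, List.getElem?_range (by omega)]
      rfl

theorem tmRule_tmHistory {A Q : Type*} {M : ℕ} (hM : 0 < M) (δ : Q → A → Q × A × TMMove)
    (c : TMConfig A Q M) (hc : (c.pos : ℕ) = 0) (k : ℕ) :
    tmRule δ c.state (tmHistory δ c k) (tmHistory δ c (k + 1)) (tmHistory δ c (k + 2))
      (tmHistory δ c (k + 3)) = tmTarget δ c k := by
  have target_small : ∀ r ≤ M + 2, tmTarget δ c r = sepEncode c r := fun r hr => by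
    simpa using tmTarget_mul_add δ c 0 hr
  obtain ⟨b, r, hr, rfl⟩ : ∃ b r, r < M + 2 ∧ k = (M + 2) * b + r :=
    ⟨k / (M + 2), k % (M + 2), Nat.mod_lt _ (by omega), (Nat.div_add_mod _ _).symm⟩
  have hist_cell : ∀ (n : ℕ) (h : n < M), tmHistory δ c (n + 3) = .sym (c.tape ⟨n, h⟩) :=
    fun n h => by simp [tmHistory, h]
  have hist_target : ∀ n, tmHistory δ c (n + (M + 3)) = tmTarget δ c n := fun n => by
    simp [tmHistory, show ¬ n + (M + 3) < 3 by omega, show ¬ n + (M + 3) - 3 < M by omega,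
      show n + (M + 3) - 3 - M = n by omega]
  rw [tmTarget_mul_add δ c b hr.le]
  rcases b with _ | b
  · simp only [mul_zero, zero_add, Function.iterate_zero, id]
    match r, hr with
    | 0, _ => simp [tmRule, tmHistory, sepEncode]
    | 1, _ =>
      rw [hist_cell 0 hM]
      simp [tmRule, tmHistory, sepEncode, encodeConfig, hc]
    | r + 2, hr =>
      have h0 : ∃ w, tmHistory δ c (r + 2) = w ∧ ∀ q, w ≠ .st q := by
        rcases r with _ | r
        · exact ⟨_, rfl, by simp [tmHistory]⟩
        · exact ⟨_, hist_cell r (by omega), by simp⟩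
      have h2 : ∃ w, tmHistory δ c (r + 4) = w ∧ ∀ q, w ≠ .st q := by
        rcases (show r + 1 ≤ M by omega).lt_or_eq with h | h
        · exact ⟨_, hist_cell (r + 1) h, by simp⟩
        · refine ⟨.sep, ?_, by simp⟩
          rw [show r + 4 = 0 + (M + 3) by omega, hist_target, target_small 0 (by omega)]
          simp [sepEncode]
      obtain ⟨w0, h0, hw0⟩ := h0
      obtain ⟨w2, h2, hw2⟩ := h2
      rw [hist_cell r (by omega), h0, h2, sepEncode, if_neg (by omega),
        encodeConfig_of_le c (by omega) (by omega)]
      cases w0 <;> cases w2 <;> simp_all [tmRule]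
  · have hist_block : ∀ n ≤ M + 2, tmHistory δ c ((M + 2) * (b + 1) + (n + 1)) =
        sepEncode ((TMstep δ)^[b] c) n := fun n hn => by
      rw [← tmTarget_mul_add δ c b hn, ← hist_target]
      congr 1
      ring
    rcases r with _ | r
    · rw [hist_block 0 (by omega)]
      simp [tmRule, sepEncode]
    · simp only [add_assoc, Nat.reduceAdd]
      rw [hist_block r (by omega), hist_block (r + 1) (by omega), hist_block (r + 2) (by omega),
        tmRule_sepEncode, Function.iterate_succ_apply', sepEncode, if_neg (by omega)]
      · omega
      · exact fun h => hist_block (r + 3) h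

/-- ARDTs simulate Turing machines: for every Turing machine with
alphabet `Σ`, state set `Q`, tape of `M` cells and runtime `steps`, there is a
decision tree over `{0,1}^{(M+3)·d}` of size at most `2^{4d}` and depth at most `4d`
(context length `L = M + 3`) such that on every input `x` written on the tape, the
induced ARDT generates, for each `i ∈ {1,…,steps}`, the block of `M + 2` tokens
`(⟨SEP⟩, sᵢ)` in positions `(i−1)(M+2)+1,…,i(M+2)`, where `sᵢ ∈ 𝔻^{M+1}` is the
encoding of the configuration of the machine at step `i`; in particular
`ℱ^Turing_{M,steps}` is simulated by ARDTs of size `O(|𝔻|⁴)`, depth `O(log|𝔻|)` and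
context length `M + 3` in length complexity `steps·(M+2) = O(M·steps)`. -/
theorem ardt_simulates_turing_machines {A Q : Type*} [Fintype A] [Fintype Q]
    (M steps : ℕ) (hM : 0 < M)
    (δ : Q → A → Q × A × TMMove) (q0 : Q)
    (Ψ : TMTok A Q → Fin (tmDim A Q) → Bool)
    (hΨ : Function.Injective Ψ) (hΨ1 : ∀ s : TMTok A Q, Ψ s 0 = true) :
    ∃ Tr : DTree (Fin ((M + 3) * tmDim A Q)) (TMTok A Q),
      Tr.size ≤ 2 ^ (4 * tmDim A Q) ∧
      Tr.depth ≤ 4 * tmDim A Q ∧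
      ∀ x : Fin M → A, ∀ i : ℕ, 1 ≤ i → i ≤ steps →
        (ardtOut Ψ TMTok.pad (M + 3) Tr (List.ofFn fun j => TMTok.sym (x j))
            ((i - 1) * (M + 2) + 1) = TMTok.sep) ∧
        ∀ j : Fin (M + 1),
          ardtOut Ψ TMTok.pad (M + 3) Tr (List.ofFn fun j => TMTok.sym (x j))
              ((i - 1) * (M + 2) + 2 + (j : ℕ))
            = encodeConfig ((TMstep δ)^[i - 1] ⟨x, ⟨0, hM⟩, q0⟩) ((j : ℕ) + 1) := by
  obtain ⟨Tr, hsize, hdepth, heval⟩ := exists_dtree_eval_encodeWindow hΨ TMTok.pad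
    (show 4 ≤ M + 3 by omega) fun w => tmRule δ q0 (w 0) (w 1) (w 2) (w 3)
  refine ⟨Tr, hsize.le, hdepth.le, fun x i hi _ => ?_⟩
  set c : TMConfig A Q M := ⟨x, ⟨0, hM⟩, q0⟩ with hc
  have hnext : ∀ k, Tr.eval (encodeWindow Ψ TMTok.pad (M + 3)
      ((List.ofFn fun j => TMTok.sym (x j)) ++ (List.range k).map (tmTarget δ c))) =
      tmTarget δ c k := by
    intro k
    rw [heval]
    have hwin := window_append_map_tmTarget δ c k
    simp only [hc] at hwin ⊢
    simp only [hwin]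
    exact tmRule_tmHistory hM δ c rfl k
  have hout : ∀ k, ardtOut Ψ TMTok.pad (M + 3) Tr (List.ofFn fun j => TMTok.sym (x j)) (k + 1) =
      tmTarget δ c k := by
    intro k
    rw [ardtOut, Nat.add_sub_cancel, ardtSeq_eq_append_map hnext, hnext]
  constructor
  · rw [hout, mul_comm, ← add_zero ((M + 2) * _), tmTarget_mul_add δ c _ (by omega)]
    simp [sepEncode]
  · intro j
    have hj := j.isLt
    rw [show (i - 1) * (M + 2) + 2 + (j : ℕ) = (M + 2) * (i - 1) + (j + 1) + 1 by ring, hout,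
      tmTarget_mul_add δ c _ (by omega), sepEncode, if_neg (by omega)]
end
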